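/- Suppose −1 < λ < 0, β > 1, and (λ, β) does not belong to Ω_k for any integer k ≥ 1. Then every periodic orbit of the map f is unstable. -/

import Mathlib

open Filter Topology

/-- The clipping function Φ. -/
noncomputable def Phi (t : ℝ) : ℝ := if t < -1 then -1 else if t ≤ 1 then t else 1

/-- The map f(x,s) = (λx + a·s, Φ(s + x' − x)). -/
noncomputable def f (lam a : ℝ) (p : ℝ × ℝ) : ℝ × ℝ :=
  (lam * p.1 + a * p.2, Phi (p.2 + (lam * p.1 + a * p.2) - p.1))

/-- Membership in the strip L = {(x,s) : |s| ≤ 1}. -/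
def inL (p : ℝ × ℝ) : Prop := |p.2| ≤ 1

/-- A trajectory of the map f, staying in the strip L. -/
def IsTraj (lam a : ℝ) (z : ℕ → ℝ × ℝ) : Prop :=
  (∀ n, inL (z n)) ∧ ∀ n, z (n + 1) = f lam a (z n)

/-- The set of fixed points of f in the strip L. -/
def fixedSet (lam a : ℝ) : Set (ℝ × ℝ) := {p | inL p ∧ f lam a p = p}

/-- Lyapunov stability of a fixed point. -/
def IsStableFixed (lam a : ℝ) (P : ℝ × ℝ) : Prop :=
  ∀ ε > 0, ∃ δ > 0, ∀ z : ℕ → ℝ × ℝ, IsTraj lam a z → dist (z 0) P < δ →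
    ∀ n, dist (z n) P < ε

/-- Semi-stability of a fixed point. -/
def IsSemiStable (lam a : ℝ) (P : ℝ × ℝ) : Prop :=
  ∃ U₁ U₂ : Set (ℝ × ℝ), IsOpen U₁ ∧ IsOpen U₂ ∧
    U₁ ⊆ {p | |p.2| < 1} ∧ U₂ ⊆ {p | |p.2| < 1} ∧
    P ∈ frontier U₁ ∧ P ∈ frontier U₂ ∧
    (∀ ε > 0, ∃ δ > 0, ∀ z : ℕ → ℝ × ℝ, IsTraj lam a z → z 0 ∈ U₁ →
      dist (z 0) P < δ → ∀ n, dist (z n) P < ε) ∧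
    (∃ ε₀ > 0, ∀ z : ℕ → ℝ × ℝ, IsTraj lam a z → z 0 ∈ U₂ →
      ∃ n, ε₀ ≤ dist (z n) P)

/-- Stability of a set (e.g. a periodic orbit) for the dynamics of f. -/
def IsStableSet (lam a : ℝ) (O : Set (ℝ × ℝ)) : Prop :=
  ∀ ε > 0, ∃ δ > 0, ∀ z : ℕ → ℝ × ℝ, IsTraj lam a z →
    Metric.infDist (z 0) O < δ → ∀ n, Metric.infDist (z n) O < ε

/-- O is a periodic orbit of f. -/
def IsPeriodicOrbit (lam a : ℝ) (O : Set (ℝ × ℝ)) : Prop :=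
  ∃ P : ℝ × ℝ, ∃ m : ℕ, 1 ≤ m ∧ inL P ∧ (f lam a)^[m] P = P ∧
    O = {q | ∃ i < m, (f lam a)^[i] P = q}

/-- P is a periodic point of minimal period k. -/
def HasMinPeriod (lam a : ℝ) (P : ℝ × ℝ) (k : ℕ) : Prop :=
  (f lam a)^[k] P = P ∧ ∀ j, 1 ≤ j → j < k → (f lam a)^[j] P ≠ P

/-- The region Ω_k in the (λ, β) parameter plane. -/
def OmegaSet (k : ℕ) : Set (ℝ × ℝ) :=
  {p | (p.2 ^ k - 1) / (p.2 - 1) ≤ -1 / p.1 ∧ -1 / p.1 < p.2 ^ k ∧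
       1 < p.2 ∧ 1 < -1 / p.1}

theorem Phi_of_le {t : ℝ} (h : t ≤ -1) : Phi t = -1 := by
  unfold Phi
  split_ifs <;> linarith

theorem Phi_of_ge {t : ℝ} (h : 1 ≤ t) : Phi t = 1 := by
  unfold Phi
  split_ifs <;> linarith

theorem Phi_of_mem {t : ℝ} (h₁ : -1 ≤ t) (h₂ : t ≤ 1) : Phi t = t := by
  unfold Phi
  split_ifs <;> linarith

theorem abs_Phi_le (t : ℝ) : |Phi t| ≤ 1 := by
  unfold Phi
  split_ifs <;> rw [abs_le] <;> constructor <;> linarith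

theorem Phi_neg (t : ℝ) : Phi (-t) = -Phi t := by
  unfold Phi
  split_ifs <;> linarith

theorem f_smul {lam a σ : ℝ} (hσ : |σ| = 1) (p : ℝ × ℝ) :
    f lam a (σ • p) = σ • f lam a p := by
  rcases (abs_eq zero_le_one).1 hσ with rfl | rfl
  · simp
  · have h := Phi_neg (p.2 + (lam * p.1 + a * p.2) - p.1)
    ext
    · simp [f]; ring
    · simp only [f, Prod.smul_fst, Prod.smul_snd, smul_eq_mul]
      rw [show -1 * p.2 + (lam * (-1 * p.1) + a * (-1 * p.2)) - -1 * p.1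
        = -(p.2 + (lam * p.1 + a * p.2) - p.1) by ring, h]
      ring

theorem f_iterate_smul {lam a σ : ℝ} (hσ : |σ| = 1) (n : ℕ) (p : ℝ × ℝ) :
    (f lam a)^[n] (σ • p) = σ • (f lam a)^[n] p :=
  (Function.Commute.iterate_left (fun q => f_smul hσ q : Function.Commute (f lam a) (σ • ·)) n) p

theorem inL_iterate {lam a : ℝ} {p : ℝ × ℝ} (hp : inL p) (n : ℕ) :
    inL ((f lam a)^[n] p) := by
  cases n with
  | zero => exact hp
  | succ n =>
    rw [Function.iterate_succ_apply']
    exact abs_Phi_le _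

theorem isTraj_iterate {lam a : ℝ} {p : ℝ × ℝ} (hp : inL p) :
    IsTraj lam a fun n => (f lam a)^[n] p :=
  ⟨inL_iterate hp, fun _ => Function.iterate_succ_apply' _ _ _⟩

/-- In the unsaturated regime the map preserves `x - s` and acts on `s` affinely. -/
theorem f_of_mem {lam β c s : ℝ} (h₁ : -1 ≤ β * s - (1 - lam) * c)
    (h₂ : β * s - (1 - lam) * c ≤ 1) :
    f lam (β - lam) (c + s, s)
      = (c + (β * s - (1 - lam) * c), β * s - (1 - lam) * c) := by
  have e : s + (lam * (c + s) + (β - lam) * s) - (c + s) = β * s - (1 - lam) * c := by ring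
  ext
  · simp only [f]; ring
  · simp only [f, e]; exact Phi_of_mem h₁ h₂

/-- The point of the edge `s = 1` with normalized coordinate `u`; `u = 0` is the fixed point. -/
noncomputable def edgePoint (lam β u : ℝ) : ℝ × ℝ := ((β - 1) / (1 - lam) * (1 + u) + 1, 1)

/-- The affine map carrying the edge coordinate to that of the opposite edge in `j` steps. -/
noncomputable def branchMap (lam β : ℝ) (j : ℕ) (u : ℝ) : ℝ :=
  ((β ^ j - 1) * ((1 - lam) / (β - 1)) - 1) * u - 2 * (1 + (1 - lam) / (β - 1))

/-- The number of steps needed to reach the opposite edge. -/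
noncomputable def exitTime (β u : ℝ) : ℕ := sInf {k : ℕ | 2 ≤ (β ^ k - 1) * u}

/-- First return map to the part `u ≥ 0` of the two edges, modulo the symmetry `p ↦ -p`. -/
noncomputable def returnMap (lam β u : ℝ) : ℝ :=
  if 0 < u then
    max (branchMap lam β (exitTime β u) u) (lam * branchMap lam β (exitTime β u) u)
  else 0

theorem exists_exitTime_eq {β u : ℝ} (hβ : 1 < β) (hu : 0 < u) :
    ∃ k, exitTime β u = k + 1 ∧ (β ^ k - 1) * u < 2 ∧ 2 ≤ (β ^ (k + 1) - 1) * u := by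
  have hne : {k : ℕ | 2 ≤ (β ^ k - 1) * u}.Nonempty := by
    obtain ⟨k, hk⟩ := pow_unbounded_of_one_lt (2 / u + 1) hβ
    refine ⟨k, ?_⟩
    have : 2 / u < β ^ k - 1 := by linarith
    exact ((div_lt_iff₀ hu).1 this).le
  have hmem := Nat.sInf_mem hne
  have h0 : exitTime β u ≠ 0 := by
    intro h
    unfold exitTime at h
    rw [h] at hmem
    norm_num at hmem
  obtain ⟨k, hk⟩ := Nat.exists_eq_succ_of_ne_zero h0
  refine ⟨k, hk, ?_, ?_⟩
  · by_contra! hc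
    have : exitTime β u ≤ k := Nat.sInf_le hc
    omega
  · unfold exitTime at hk
    rw [hk] at hmem
    exact hmem

/-- `u` lies in the closed interval of coordinates that need `k + 1` steps to cross. -/
def OnBranch (β : ℝ) (k : ℕ) (u : ℝ) : Prop :=
  (β ^ k - 1) * u ≤ 2 ∧ 2 ≤ (β ^ (k + 1) - 1) * u

theorem branchMap_succ_le {lam β u : ℝ} {k : ℕ} (h2 : lam < 0) (hβ : 1 < β)
    (hk : (β ^ k - 1) * u ≤ 2) : branchMap lam β (k + 1) u ≤ -lam * (u + 2) := by
  have hK : 0 < (1 - lam) / (β - 1) := div_pos (by linarith) (by linarith)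
  have hKe : (1 - lam) / (β - 1) * (β - 1) = 1 - lam := div_mul_cancel₀ _ (by linarith)
  unfold branchMap
  generalize (1 - lam) / (β - 1) = K at *
  have e : ((β ^ (k + 1) - 1) * K - 1) * u - 2 * (1 + K)
      = β * K * ((β ^ k - 1) * u - 2) + (K * (β - 1)) * (u + 2) - u - 2 := by ring
  have := mul_nonneg (mul_nonneg (by linarith : 0 ≤ β) hK.le) (sub_nonneg.2 hk)
  rw [e, hKe]
  linarith

theorem le_branchMap {lam β u : ℝ} {k : ℕ} (h2 : lam < 0) (hβ : 1 < β)
    (hk : 2 ≤ (β ^ k - 1) * u) : -(u + 2) ≤ branchMap lam β k u := by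
  have hK : 0 < (1 - lam) / (β - 1) := div_pos (by linarith) (by linarith)
  unfold branchMap
  have := mul_nonneg hK.le (sub_nonneg.2 hk)
  linarith

theorem max_branchMap_of_eq {lam β u : ℝ} {k : ℕ} (h2 : lam < 0) (hβ : 1 < β) (hu : 0 < u)
    (hk : (β ^ k - 1) * u = 2) :
    max (branchMap lam β k u) (lam * branchMap lam β k u)
      = max (branchMap lam β (k + 1) u) (lam * branchMap lam β (k + 1) u) := by
  have hKe : (1 - lam) / (β - 1) * (β - 1) = 1 - lam := div_mul_cancel₀ _ (by linarith)
  have e₁ : branchMap lam β k u = -(u + 2) := by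
    unfold branchMap
    linear_combination (1 - lam) / (β - 1) * hk
  have e₂ : branchMap lam β (k + 1) u = -lam * (u + 2) := by
    unfold branchMap
    linear_combination β * ((1 - lam) / (β - 1)) * hk + (u + 2) * hKe
  have h := mul_pos (neg_pos.2 h2) (by linarith : 0 < u + 2)
  rw [e₁, e₂, max_eq_right (by linarith), max_eq_left (by nlinarith)]
  ring

theorem returnMap_eq {lam β u : ℝ} {k : ℕ} (h2 : lam < 0) (hβ : 1 < β) (hu : 0 < u)
    (hk : OnBranch β k u) : returnMap lam β u =
      max (branchMap lam β (k + 1) u) (lam * branchMap lam β (k + 1) u) := by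
  obtain ⟨j, hj, hj₁, hj₂⟩ := exists_exitTime_eq hβ hu
  rw [returnMap, if_pos hu, hj]
  have hlt : j < k + 1 := by
    by_contra! hc
    have : β ^ (k + 1) ≤ β ^ j := pow_le_pow_right₀ hβ.le hc
    have := hk.2
    nlinarith
  rcases Nat.lt_succ_iff_lt_or_eq.1 hlt with h | rfl
  · have h₁ : β ^ (j + 1) ≤ β ^ k := pow_le_pow_right₀ hβ.le h
    have h₂ : β ^ (j + 1) = β ^ k := by
      have := hk.1
      apply le_antisymm h₁
      nlinarith
    obtain rfl : j + 1 = k := pow_right_injective₀ (by linarith) hβ.ne' h₂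
    exact max_branchMap_of_eq h2 hβ hu (le_antisymm hk.1 hj₂)
  · rfl

theorem returnMap_zero (lam β : ℝ) : returnMap lam β 0 = 0 := by simp [returnMap]

theorem returnMap_nonneg {lam β : ℝ} (h2 : lam < 0) (u : ℝ) : 0 ≤ returnMap lam β u := by
  unfold returnMap
  split_ifs
  · rcases le_total 0 (branchMap lam β (exitTime β u) u) with h | h
    · exact le_max_of_le_left h
    · exact le_max_of_le_right (mul_nonneg_of_nonpos_of_nonpos h2.le h)
  · exact le_rfl

theorem returnMap_le {lam β u : ℝ} (h2 : lam < 0) (hβ : 1 < β) (hu : 0 ≤ u) :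
    returnMap lam β u ≤ -lam * (u + 2) := by
  rcases hu.eq_or_lt with rfl | hu
  · rw [returnMap_zero]; linarith
  obtain ⟨k, -, hk₁, hk₂⟩ := exists_exitTime_eq hβ hu
  rw [returnMap_eq h2 hβ hu ⟨hk₁.le, hk₂⟩]
  have h₁ := branchMap_succ_le h2 hβ hk₁.le
  have h₂ := le_branchMap h2 hβ hk₂
  exact max_le h₁ (by nlinarith)

theorem eventually_onBranch {β u : ℝ} (hβ : 1 < β) (hu : 0 < u) :
    ∃ k, ∀ᶠ v in 𝓝 u, (OnBranch β k u ∧ OnBranch β k v) ∨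
      (OnBranch β (k + 1) u ∧ OnBranch β (k + 1) v) := by
  obtain ⟨k, -, hk₁, hk₂⟩ := exists_exitTime_eq hβ hu
  have hc : ∀ j : ℕ, ContinuousAt (fun v : ℝ => (β ^ j - 1) * v) u := fun j => by fun_prop
  have hlt : β ^ (k + 1) < β ^ (k + 1 + 1) := pow_lt_pow_right₀ hβ (by omega)
  have hk₃ : 2 < (β ^ (k + 1 + 1) - 1) * u := by nlinarith
  refine ⟨k, ?_⟩
  rcases hk₂.eq_or_lt with he | hlt'
  · filter_upwards [(hc k).eventually_lt_const hk₁, (hc (k + 1 + 1)).eventually_const_lt hk₃]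
      with v hv₁ hv₂
    rcases le_total 2 ((β ^ (k + 1) - 1) * v) with h | h
    · exact Or.inl ⟨⟨hk₁.le, hk₂⟩, hv₁.le, h⟩
    · exact Or.inr ⟨⟨he.ge, hk₃.le⟩, h, hv₂.le⟩
  · filter_upwards [(hc k).eventually_lt_const hk₁, (hc (k + 1)).eventually_const_lt hlt']
      with v hv₁ hv₂
    exact Or.inl ⟨⟨hk₁.le, hk₂⟩, hv₁.le, hv₂.le⟩

theorem continuous_branchMap (lam β : ℝ) (j : ℕ) : Continuous (branchMap lam β j) := by
  unfold branchMap
  fun_prop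

theorem continuousAt_returnMap {lam β u : ℝ} (h2 : lam < 0) (hβ : 1 < β) (hu : 0 < u) :
    ContinuousAt (returnMap lam β) u := by
  obtain ⟨k, hk⟩ := eventually_onBranch hβ hu
  have hc : ∀ j : ℕ, Continuous fun v =>
      max (branchMap lam β j v) (lam * branchMap lam β j v) := fun j =>
    (continuous_branchMap lam β j).max ((continuous_branchMap lam β j).const_mul lam)
  rw [Metric.continuousAt_iff']
  intro ε hε
  filter_upwards [hk, lt_mem_nhds hu, Metric.continuousAt_iff'.1 (hc (k + 1)).continuousAt ε hε,
    Metric.continuousAt_iff'.1 (hc (k + 1 + 1)).continuousAt ε hε] with v hv hv0 h₁ h₂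
  rcases hv with ⟨hbu, hbv⟩ | ⟨hbu, hbv⟩
  · rwa [returnMap_eq h2 hβ hu hbu, returnMap_eq h2 hβ hv0 hbv]
  · rwa [returnMap_eq h2 hβ hu hbu, returnMap_eq h2 hβ hv0 hbv]

theorem abs_max_sub_max {lam g g' : ℝ} (h1 : -1 < lam) (h2 : lam < 0) (h : 0 < g * g') :
    -lam * |g' - g| ≤ |max g' (lam * g') - max g (lam * g)| := by
  rcases pos_and_pos_or_neg_and_neg_of_mul_pos h with ⟨hg, hg'⟩ | ⟨hg, hg'⟩
  · rw [max_eq_left (by nlinarith), max_eq_left (by nlinarith)]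
    nlinarith [abs_nonneg (g' - g)]
  · rw [max_eq_right (by nlinarith), max_eq_right (by nlinarith), ← mul_sub, abs_mul,
      abs_of_neg h2]

/-- The return map expands near every point of branches of index at least `k₀`. -/
theorem eventually_expand {lam β u : ℝ} {k₀ : ℕ} (h1 : -1 < lam) (h2 : lam < 0) (hβ : 1 < β)
    (hu : 0 < u) (hRu : 0 < returnMap lam β u) :
    ∀ᶠ v in 𝓝 u, (β ^ k₀ - 1) * v < 2 →
      -lam * ((β ^ (k₀ + 1) - 1) * ((1 - lam) / (β - 1)) - 1) * |v - u|
        ≤ |returnMap lam β v - returnMap lam β u| := by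
  have hK : 0 < (1 - lam) / (β - 1) := div_pos (by linarith) (by linarith)
  obtain ⟨k, hk⟩ := eventually_onBranch hβ hu
  have hsign : ∀ j : ℕ, ∀ᶠ v in 𝓝 u, branchMap lam β j u ≠ 0 →
      0 < branchMap lam β j u * branchMap lam β j v := by
    intro j
    by_cases h0 : branchMap lam β j u = 0
    · exact Eventually.of_forall fun v h => absurd h0 h
    · have : ContinuousAt (fun v => branchMap lam β j u * branchMap lam β j v) u :=
        ((continuous_branchMap lam β j).const_mul _).continuousAt
      filter_upwards [this.eventually_const_lt (mul_self_pos.2 h0)] with v hv _ using hv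
  have key : ∀ (j : ℕ) (v : ℝ), 0 < v → (β ^ k₀ - 1) * v < 2 → OnBranch β j u → OnBranch β j v →
      (branchMap lam β (j + 1) u ≠ 0 →
        0 < branchMap lam β (j + 1) u * branchMap lam β (j + 1) v) →
      -lam * ((β ^ (k₀ + 1) - 1) * ((1 - lam) / (β - 1)) - 1) * |v - u|
        ≤ |returnMap lam β v - returnMap lam β u| := by
    intro j v hv0 hv hbu hbv hs
    rw [returnMap_eq h2 hβ hu hbu] at hRu ⊢
    rw [returnMap_eq h2 hβ hv0 hbv]
    have hne : branchMap lam β (j + 1) u ≠ 0 := by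
      intro h
      simp [h] at hRu
    have hj : k₀ ≤ j := by
      by_contra! hc
      have : β ^ (j + 1) ≤ β ^ k₀ := pow_le_pow_right₀ hβ.le hc
      have := hbv.2
      nlinarith
    have hpow : β ^ (k₀ + 1) ≤ β ^ (j + 1) := pow_le_pow_right₀ hβ.le (by omega)
    refine le_trans ?_ (abs_max_sub_max h1 h2 (hs hne))
    have e : branchMap lam β (j + 1) v - branchMap lam β (j + 1) u
        = ((β ^ (j + 1) - 1) * ((1 - lam) / (β - 1)) - 1) * (v - u) := by
      unfold branchMap; ring
    rw [e, abs_mul, mul_assoc]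
    refine mul_le_mul_of_nonneg_left (mul_le_mul_of_nonneg_right (le_trans ?_ (le_abs_self _))
      (abs_nonneg _)) (by linarith)
    gcongr
  filter_upwards [hk, lt_mem_nhds hu, hsign (k + 1), hsign (k + 1 + 1)] with v hv hv0 h₁ h₂ hv'
  rcases hv with ⟨hbu, hbv⟩ | ⟨hbu, hbv⟩
  · exact key _ v hv0 hv' hbu hbv h₁
  · exact key _ v hv0 hv' hbu hbv h₂

theorem f_iterate_edgePoint {lam β u : ℝ} (h2 : lam < 0) (hu : 0 < u) {k i : ℕ}
    (hβ : 1 < β) (hk : (β ^ k - 1) * u ≤ 2) (hi : i ≤ k) :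
    (f lam (β - lam))^[i] (edgePoint lam β u) =
      ((β - 1) / (1 - lam) * (1 + u) + (1 - (β ^ i - 1) * u), 1 - (β ^ i - 1) * u) := by
  have hκ : (1 - lam) * ((β - 1) / (1 - lam)) = β - 1 := mul_div_cancel₀ _ (by linarith)
  induction i with
  | zero => simp [edgePoint]
  | succ i ih =>
    have e : β * (1 - (β ^ i - 1) * u) - (1 - lam) * ((β - 1) / (1 - lam) * (1 + u))
        = 1 - (β ^ (i + 1) - 1) * u := by
      linear_combination (-(1 + u)) * hκ
    have hp : 1 ≤ β ^ (i + 1) := one_le_pow₀ hβ.le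
    have hp' : β ^ (i + 1) ≤ β ^ k := pow_le_pow_right₀ hβ.le hi
    rw [Function.iterate_succ_apply', ih (by omega), f_of_mem, e]
    · rw [e]; nlinarith
    · rw [e]; nlinarith

theorem f_edgePoint_of_nonpos {lam β u : ℝ} (h2 : lam < 0) (hβ : 1 < β) (hu : u ≤ 0) :
    f lam (β - lam) (edgePoint lam β u) = edgePoint lam β (lam * u) := by
  have hκ : (1 - lam) * ((β - 1) / (1 - lam)) = β - 1 := mul_div_cancel₀ _ (by linarith)
  ext
  · simp only [f, edgePoint]
    linear_combination (-1 : ℝ) * hκ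
  · simp only [f, edgePoint]
    apply Phi_of_ge
    have : 1 + (lam * ((β - 1) / (1 - lam) * (1 + u) + 1) + (β - lam) * 1)
      - ((β - 1) / (1 - lam) * (1 + u) + 1) = 1 - (β - 1) * u := by
      linear_combination (-(1 + u)) * hκ
    rw [this]
    nlinarith

theorem exists_iterate_eq_returnMap {lam β u : ℝ} (h2 : lam < 0) (hβ : 1 < β) (hu : 0 ≤ u) :
    ∃ (n : ℕ) (σ : ℝ), |σ| = 1 ∧ (f lam (β - lam))^[n] (edgePoint lam β u)
      = σ • edgePoint lam β (returnMap lam β u) := by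
  rcases hu.eq_or_lt with rfl | hu
  · exact ⟨0, 1, by simp, by simp [returnMap_zero]⟩
  obtain ⟨k, -, hk₁, hk₂⟩ := exists_exitTime_eq hβ hu
  have hκ : (1 - lam) * ((β - 1) / (1 - lam)) = β - 1 := mul_div_cancel₀ _ (by linarith)
  have hκK : (β - 1) / (1 - lam) * ((1 - lam) / (β - 1)) = 1 := by
    have : β - 1 ≠ 0 := by linarith
    have : 1 - lam ≠ 0 := by linarith
    field_simp
  have hcross : (f lam (β - lam))^[k + 1] (edgePoint lam β u)
      = (-1 : ℝ) • edgePoint lam β (branchMap lam β (k + 1) u) := by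
    rw [Function.iterate_succ_apply', f_iterate_edgePoint h2 hu hβ hk₁.le le_rfl]
    ext
    · simp only [f, edgePoint, branchMap, Prod.smul_fst, smul_eq_mul]
      linear_combination (-(1 + u)) * hκ + ((β ^ (k + 1) - 1) * u - 2) * hκK
    · simp only [f, edgePoint, Prod.smul_snd, smul_eq_mul]
      rw [mul_one]
      apply Phi_of_le
      have : (1 - (β ^ k - 1) * u) + (lam * ((β - 1) / (1 - lam) * (1 + u) + (1 - (β ^ k - 1) * u))
          + (β - lam) * (1 - (β ^ k - 1) * u))
          - ((β - 1) / (1 - lam) * (1 + u) + (1 - (β ^ k - 1) * u))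
          = 1 - (β ^ (k + 1) - 1) * u := by
        linear_combination (-(1 + u)) * hκ
      rw [this]
      linarith
  rw [returnMap_eq h2 hβ hu ⟨hk₁.le, hk₂⟩]
  rcases le_total 0 (branchMap lam β (k + 1) u) with h | h
  · exact ⟨k + 1, -1, by simp, by rw [hcross, max_eq_left (by nlinarith)]⟩
  · refine ⟨k + 1 + 1, -1, by simp, ?_⟩
    rw [Function.iterate_succ_apply', hcross, f_smul (by simp), f_edgePoint_of_nonpos h2 hβ h,
      max_eq_right (by nlinarith)]

theorem exists_iterate_eq_returnMap_iterate {lam β u : ℝ} (h2 : lam < 0) (hβ : 1 < β)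
    (hu : 0 ≤ u) (n : ℕ) :
    ∃ (N : ℕ) (σ : ℝ), |σ| = 1 ∧ (f lam (β - lam))^[N] (edgePoint lam β u)
      = σ • edgePoint lam β ((returnMap lam β)^[n] u) := by
  induction n with
  | zero => exact ⟨0, 1, by simp, by simp⟩
  | succ n ih =>
    obtain ⟨N, σ, hσ, hN⟩ := ih
    have hn : 0 ≤ (returnMap lam β)^[n] u := by
      cases n with
      | zero => exact hu
      | succ n => rw [Function.iterate_succ_apply']; exact returnMap_nonneg h2 _
    obtain ⟨N', τ, hτ, hN'⟩ := exists_iterate_eq_returnMap h2 hβ hn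
    refine ⟨N' + N, σ * τ, by rw [abs_mul, hσ, hτ, one_mul], ?_⟩
    rw [Function.iterate_add_apply, hN, f_iterate_smul hσ, hN', smul_smul,
      Function.iterate_succ_apply']

/-- A locally expanding map of the line pushes points away from a finite invariant set. -/
theorem exists_escape_of_expanding {R : ℝ → ℝ} {U U' V : Set ℝ} {γ : ℝ} (hγ : 1 < γ)
    (hU : U.Finite) (hU' : U' ⊆ U) (hRU : Set.MapsTo R U' U') (hRV : Set.MapsTo R V V)
    (hexp : ∀ u ∈ U', ∀ᶠ v in 𝓝 u, v ∈ V → γ * |v - u| ≤ |R v - R u|)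
    (hcont : ∀ u ∈ U', ContinuousAt R u) :
    ∃ ε > 0, ∀ u ∈ U', ∀ v ∈ V, v ≠ u → |v - u| < ε →
      ∃ n : ℕ, ∀ w ∈ U, ε ≤ |R^[n] v - w| := by
  obtain ⟨ρ, hρ, hsep⟩ : ∃ ρ > 0, ∀ u ∈ U, ∀ w ∈ U, |u - w| < ρ → u = w := by
    have h : ∀ᶠ ρ in 𝓝[>] (0 : ℝ), ∀ u ∈ U, ∀ w ∈ U, |u - w| < ρ → u = w := by
      rw [eventually_all_finite hU]
      intro u _
      rw [eventually_all_finite hU]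
      intro w _
      by_cases huw : u = w
      · exact Eventually.of_forall fun _ _ => huw
      · have : 0 < |u - w| := abs_pos.2 (sub_ne_zero.2 huw)
        filter_upwards [mem_nhdsWithin_of_mem_nhds (gt_mem_nhds this)] with ρ h₁ h₂
        exact absurd h₁ h₂.not_gt
    obtain ⟨ρ, h, hρ⟩ := (h.and self_mem_nhdsWithin).exists
    exact ⟨ρ, hρ, h⟩
  obtain ⟨ε, hε, hερ, hloc⟩ : ∃ ε > 0, ε < ρ / 2 ∧ ∀ u ∈ U', ∀ v, |v - u| < ε →
      (v ∈ V → γ * |v - u| ≤ |R v - R u|) ∧ |R v - R u| < ρ / 2 := by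
    have h : ∀ᶠ ε in 𝓝[>] (0 : ℝ), ∀ u ∈ U', ∀ v, |v - u| < ε →
        (v ∈ V → γ * |v - u| ≤ |R v - R u|) ∧ |R v - R u| < ρ / 2 := by
      rw [eventually_all_finite (hU.subset hU')]
      intro u hu
      obtain ⟨ε, hε, h⟩ := Metric.eventually_nhds_iff.1 ((hexp u hu).and
        (Metric.continuousAt_iff'.1 (hcont u hu) (ρ / 2) (half_pos hρ)))
      filter_upwards [mem_nhdsWithin_of_mem_nhds (gt_mem_nhds hε)] with ε' hε' v hv
      exact h (lt_trans hv hε')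
    obtain ⟨ε, ⟨h, hε⟩, hερ⟩ := ((h.and self_mem_nhdsWithin).and
      (mem_nhdsWithin_of_mem_nhds (gt_mem_nhds (half_pos hρ)))).exists
    exact ⟨ε, hε, hερ, h⟩
  refine ⟨ε, hε, fun u hu v hv hvu hlt => ?_⟩
  by_contra! hclose
  have hshadow : ∀ n, |R^[n] v - R^[n] u| < ε ∧ γ ^ n * |v - u| ≤ |R^[n] v - R^[n] u| := by
    intro n
    induction n with
    | zero => simpa using hlt
    | succ n ih =>
      obtain ⟨hnear, hgrow⟩ := ih
      have hun := hRU.iterate n hu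
      obtain ⟨h₁, h₂⟩ := hloc _ hun _ hnear
      have h₁ := h₁ (hRV.iterate n hv)
      obtain ⟨w, hw, hwlt⟩ := hclose (n + 1)
      have hmem := hU' (hRU.iterate (n + 1) hu)
      simp only [Function.iterate_succ_apply'] at hwlt hmem ⊢
      obtain rfl : w = R (R^[n] u) := by
        apply hsep w hw _ hmem
        have := abs_sub_le w (R (R^[n] v)) (R (R^[n] u))
        rw [abs_sub_comm w (R (R^[n] v))] at this
        linarith
      refine ⟨hwlt, le_trans ?_ h₁⟩
      rw [pow_succ']
      nlinarith
  have hpos : 0 < |v - u| := abs_pos.2 (sub_ne_zero.2 hvu)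
  obtain ⟨n, hn⟩ := pow_unbounded_of_one_lt (ε / |v - u|) hγ
  rw [div_lt_iff₀ hpos] at hn
  have := hshadow n
  linarith

/-- Every fixed point of the map is unstable when `β > 1`. -/
theorem not_isStableSet_singleton {lam β : ℝ} (hβ : 1 < β) {P : ℝ × ℝ}
    (hP : inL P) (hfix : f lam (β - lam) P = P) : ¬ IsStableSet lam (β - lam) {P} := by
  intro hst
  obtain ⟨x, s⟩ := P
  have hx : lam * x + (β - lam) * s = x := congrArg Prod.fst hfix
  obtain ⟨hs₁, hs₂⟩ := abs_le.1 (show |s| ≤ 1 from hP)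
  obtain ⟨δ, hδ, hstab⟩ := hst (1 / 2) (by norm_num)
  obtain ⟨σ, hσ, hσs⟩ : ∃ σ : ℝ, |σ| = 1 ∧ 0 ≤ σ * s := by
    rcases le_total 0 s with h | h
    · exact ⟨1, by simp, by linarith⟩
    · exact ⟨-1, by simp, by linarith⟩
  obtain ⟨η, hη, hηlt⟩ := exists_between (lt_min hδ (by norm_num : (0 : ℝ) < 1 / 2))
  obtain ⟨hηδ, hη2⟩ := lt_min_iff.1 hηlt
  have hbound : ∀ r : ℝ, 0 ≤ r → r < 1 → -1 ≤ s - r * σ ∧ s - r * σ ≤ 1 := by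
    intro r hr hr1
    rcases (abs_eq zero_le_one).1 hσ with rfl | rfl <;> constructor <;> linarith
  have hdist : ∀ t : ℝ, dist ((x - s) + t, t) (x, s) = |t - s| := by
    intro t
    rw [Prod.dist_eq, Real.dist_eq, Real.dist_eq, show x - s + t - x = t - s by ring, max_self]
  have hin : inL ((x - s) + (s - η * σ), s - η * σ) :=
    abs_le.2 (hbound η hη.le (by linarith))
  have habs : ∀ r : ℝ, 0 ≤ r → |s - r * σ - s| = r := by
    intro r hr
    rw [show s - r * σ - s = -(r * σ) by ring, abs_neg, abs_mul, hσ, mul_one, abs_of_nonneg hr]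
  have hclose := hstab _ (isTraj_iterate hin) (by
    rw [Metric.infDist_singleton]
    simp only [Function.iterate_zero, id]
    rwa [hdist, habs _ hη.le])
  have horb : ∀ n : ℕ, β ^ n * η < 1 / 2 ∧ (f lam (β - lam))^[n]
      ((x - s) + (s - η * σ), s - η * σ)
        = ((x - s) + (s - β ^ n * η * σ), s - β ^ n * η * σ) := by
    intro n
    induction n with
    | zero => simpa using hη2
    | succ n ih =>
      obtain ⟨hlt, heq⟩ := ih
      have hpos : 0 < β ^ (n + 1) * η := by positivity
      have e : β * (s - β ^ n * η * σ) - (1 - lam) * (x - s) = s - β ^ (n + 1) * η * σ := by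
        linear_combination hx
      have hcl := hclose (n + 1)
      rw [Metric.infDist_singleton] at hcl
      simp only [Function.iterate_succ_apply'] at hcl ⊢
      rw [heq] at hcl ⊢
      have hle : β ^ (n + 1) * η < 1 + |s| := by
        by_contra! hge
        have hdist' : |Phi (s - β ^ (n + 1) * η * σ) - s| < 1 / 2 := by
          refine lt_of_le_of_lt ?_ hcl
          rw [← e, Prod.dist_eq, Real.dist_eq, Real.dist_eq]
          refine le_max_of_le_right (le_of_eq ?_)
          simp only [f]
          congr 3
          ring
        rcases (abs_eq zero_le_one).1 hσ with rfl | rfl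
        · rw [abs_of_nonneg (by linarith)] at hge
          rw [Phi_of_le (by linarith)] at hdist'
          have := (abs_lt.1 hdist').1
          linarith
        · rw [abs_of_nonpos (by linarith)] at hge
          rw [Phi_of_ge (by linarith)] at hdist'
          have := (abs_lt.1 hdist').2
          linarith
      have hb : -1 ≤ s - β ^ (n + 1) * η * σ ∧ s - β ^ (n + 1) * η * σ ≤ 1 := by
        rcases (abs_eq zero_le_one).1 hσ with rfl | rfl
        · rw [abs_of_nonneg (by linarith)] at hle
          constructor <;> linarith
        · rw [abs_of_nonpos (by linarith)] at hle
          constructor <;> linarith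
      rw [f_of_mem (by rw [e]; exact hb.1) (by rw [e]; exact hb.2), e] at hcl ⊢
      rw [hdist, habs _ hpos.le] at hcl
      exact ⟨hcl, rfl⟩
  obtain ⟨n, hn⟩ := pow_unbounded_of_one_lt (1 / 2 / η) hβ
  rw [div_lt_iff₀ hη] at hn
  linarith [(horb n).1]

/-- A periodic point whose orbit never meets the edges is fixed. -/
theorem fixed_of_periodic_of_abs_lt {lam β : ℝ} (hβ : 1 < β) {P : ℝ × ℝ} {m : ℕ} (hm : 1 ≤ m)
    (hper : (f lam (β - lam))^[m] P = P)
    (hinside : ∀ n, |((f lam (β - lam))^[n] P).2| < 1) : f lam (β - lam) P = P := by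
  obtain ⟨x, s⟩ := P
  have hstep : ∀ n, (f lam (β - lam))^[n] (x, s) = ((x - s) +
      (s + (β ^ n - 1) / (β - 1) * ((β - lam) * s - (1 - lam) * x)),
      s + (β ^ n - 1) / (β - 1) * ((β - lam) * s - (1 - lam) * x)) := by
    intro n
    induction n with
    | zero => simp
    | succ n ih =>
      have h := hinside (n + 1)
      rw [Function.iterate_succ_apply', ih] at h ⊢
      have e : β * (s + (β ^ n - 1) / (β - 1) * ((β - lam) * s - (1 - lam) * x))
          - (1 - lam) * (x - s)
          = s + (β ^ (n + 1) - 1) / (β - 1) * ((β - lam) * s - (1 - lam) * x) := by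
        have : β - 1 ≠ 0 := by linarith
        field_simp
        ring
      have hmem : -1 ≤ s + (β ^ (n + 1) - 1) / (β - 1) * ((β - lam) * s - (1 - lam) * x) ∧
          s + (β ^ (n + 1) - 1) / (β - 1) * ((β - lam) * s - (1 - lam) * x) ≤ 1 := by
        have h' : |Phi (s + (β ^ (n + 1) - 1) / (β - 1) *
            ((β - lam) * s - (1 - lam) * x))| < 1 := by
          refine lt_of_eq_of_lt ?_ h
          rw [← e]
          simp only [f]
          congr 2
          ring
        constructor
        · by_contra! hc
          rw [Phi_of_le hc.le] at h'
          norm_num at h'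
        · by_contra! hc
          rw [Phi_of_ge hc.le] at h'
          norm_num at h'
      rw [f_of_mem (by rw [e]; exact hmem.1) (by rw [e]; exact hmem.2), e]
  have hs := congrArg Prod.snd ((hstep m).symm.trans hper)
  have hpow : 1 < β ^ m := one_lt_pow₀ hβ (by omega)
  have hz : (β - lam) * s - (1 - lam) * x = 0 := by
    have : (β ^ m - 1) / (β - 1) ≠ 0 := (div_pos (by linarith) (by linarith)).ne'
    simpa [this] using hs
  have := hstep 1
  rw [hz] at this
  simpa using this


section PeriodicOrbit

variable {lam a : ℝ} {O : Set (ℝ × ℝ)}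

theorem IsPeriodicOrbit.finite (hO : IsPeriodicOrbit lam a O) : O.Finite := by
  obtain ⟨P, m, -, -, -, rfl⟩ := hO
  exact (Set.finite_lt_nat m).image fun i => (f lam a)^[i] P

theorem IsPeriodicOrbit.nonempty (hO : IsPeriodicOrbit lam a O) : O.Nonempty := by
  obtain ⟨P, m, hm, -, -, rfl⟩ := hO
  exact ⟨P, 0, hm, rfl⟩

theorem IsPeriodicOrbit.inL_of_mem (hO : IsPeriodicOrbit lam a O) {p : ℝ × ℝ} (hp : p ∈ O) :
    inL p := by
  obtain ⟨P, m, -, hP, -, rfl⟩ := hO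
  obtain ⟨i, -, rfl⟩ := hp
  exact inL_iterate hP i

theorem IsPeriodicOrbit.mapsTo (hO : IsPeriodicOrbit lam a O) :
    Set.MapsTo (f lam a) O O := by
  obtain ⟨P, m, hm, -, hper, rfl⟩ := hO
  rintro _ ⟨i, hi, rfl⟩
  rcases (Nat.succ_le_of_lt hi).lt_or_eq with h | h
  · exact ⟨i + 1, h, Function.iterate_succ_apply' _ _ _⟩
  · refine ⟨0, hm, ?_⟩
    rw [← Function.iterate_succ_apply' (f lam a), h, hper]
    rfl

theorem IsPeriodicOrbit.eq_singleton (hO : IsPeriodicOrbit lam a O) {p : ℝ × ℝ} (hp : p ∈ O)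
    (hfix : f lam a p = p) : O = {p} := by
  obtain ⟨P, m, hm, -, hper, rfl⟩ := hO
  obtain ⟨i, hi, rfl⟩ := hp
  have hfix' : Function.IsFixedPt (f lam a) ((f lam a)^[i] P) := hfix
  have hP : P = (f lam a)^[i] P := by
    have h := hfix'.iterate (m - i)
    rw [Function.IsFixedPt, ← Function.iterate_add_apply, Nat.sub_add_cancel hi.le, hper] at h
    exact h
  rw [← hP] at hfix' ⊢
  ext q
  constructor
  · rintro ⟨j, -, rfl⟩
    exact hfix'.iterate j
  · rintro rfl
    exact ⟨0, hm, rfl⟩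

end PeriodicOrbit

theorem edgePoint_injective {lam β : ℝ} (h2 : lam < 0) (hβ : 1 < β) :
    Function.Injective (edgePoint lam β) := by
  intro u v h
  have hκ : (β - 1) / (1 - lam) ≠ 0 := (div_pos (by linarith) (by linarith)).ne'
  simpa [edgePoint, hκ] using h

/-- A point on one of the two edges is, up to symmetry, an edge point. -/
theorem eq_smul_edgePoint {lam β σ : ℝ} (h2 : lam < 0) (hβ : 1 < β) (hσ : |σ| = 1)
    {p : ℝ × ℝ} (hp : p.2 = σ) :
    p = σ • edgePoint lam β ((σ * p.1 - 1) / ((β - 1) / (1 - lam)) - 1) := by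
  have hκ : (β - 1) / (1 - lam) ≠ 0 := (div_pos (by linarith) (by linarith)).ne'
  have hσσ : σ * σ = 1 := by rw [← abs_mul_abs_self, hσ, one_mul]
  ext
  · simp only [edgePoint, Prod.smul_fst, smul_eq_mul]
    rw [add_sub_cancel, mul_div_cancel₀ _ hκ]
    linear_combination (-p.1) * hσσ
  · simpa [edgePoint] using hp

/-- The normalized coordinates of the edge points of a set, modulo the symmetry. -/
def edgeCoords (lam β : ℝ) (O : Set (ℝ × ℝ)) : Set ℝ :=
  {u | ∃ σ : ℝ, |σ| = 1 ∧ σ • edgePoint lam β u ∈ O}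

theorem finite_edgeCoords {lam β : ℝ} (h2 : lam < 0) (hβ : 1 < β) {O : Set (ℝ × ℝ)}
    (hO : O.Finite) : (edgeCoords lam β O).Finite := by
  have h : ∀ σ : ℝ, |σ| = 1 → {u | σ • edgePoint lam β u ∈ O}.Finite := by
    intro σ hσ
    have hσ0 : σ ≠ 0 := by
      rintro rfl
      simp at hσ
    exact hO.preimage
      (((smul_right_injective _ hσ0).comp (edgePoint_injective h2 hβ)).injOn)
  refine ((h 1 (by simp)).union (h (-1) (by simp))).subset ?_
  rintro u ⟨σ, hσ, hu⟩
  rcases (abs_eq zero_le_one).1 hσ with rfl | rfl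
  · exact Or.inl hu
  · exact Or.inr hu

theorem returnMap_mem_edgeCoords {lam β u : ℝ} (h2 : lam < 0) (hβ : 1 < β) {O : Set (ℝ × ℝ)}
    (hO : Set.MapsTo (f lam (β - lam)) O O) (hu0 : 0 ≤ u) (hu : u ∈ edgeCoords lam β O) :
    returnMap lam β u ∈ edgeCoords lam β O := by
  obtain ⟨σ, hσ, hu⟩ := hu
  obtain ⟨n, τ, hτ, hn⟩ := exists_iterate_eq_returnMap h2 hβ hu0
  refine ⟨σ * τ, by rw [abs_mul, hσ, hτ, one_mul], ?_⟩
  rw [mul_smul, ← hn, ← f_iterate_smul hσ]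
  exact hO.iterate n hu

/-- A periodic orbit other than a fixed point meets an edge at a positive coordinate, and never at
coordinate zero. -/
theorem IsPeriodicOrbit.fixed_or_edgeCoords {lam β : ℝ} (h2 : lam < 0) (hβ : 1 < β)
    {O : Set (ℝ × ℝ)} (hO : IsPeriodicOrbit lam (β - lam) O) :
    (∃ p ∈ O, f lam (β - lam) p = p) ∨
      ((0 : ℝ) ∉ edgeCoords lam β O ∧ ∃ u ∈ edgeCoords lam β O, 0 < u) := by
  by_cases h0 : (0 : ℝ) ∈ edgeCoords lam β O
  · obtain ⟨σ, hσ, h⟩ := h0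
    exact Or.inl ⟨_, h, by rw [f_smul hσ, f_edgePoint_of_nonpos h2 hβ le_rfl, mul_zero]⟩
  by_cases hne : ∃ u, u ∈ edgeCoords lam β O
  · obtain ⟨u, hu⟩ := hne
    refine Or.inr ⟨h0, ?_⟩
    rcases lt_trichotomy u 0 with hneg | rfl | hpos
    · obtain ⟨σ, hσ, h⟩ := hu
      refine ⟨lam * u, ⟨σ, hσ, ?_⟩, mul_pos_of_neg_of_neg h2 hneg⟩
      rw [← f_edgePoint_of_nonpos h2 hβ hneg.le, ← f_smul hσ]
      exact hO.mapsTo h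
    · exact absurd hu h0
    · exact ⟨u, hu, hpos⟩
  · have hinside : ∀ p ∈ O, |p.2| < 1 := by
      intro p hp
      refine lt_of_le_of_ne (hO.inL_of_mem hp) fun h => ?_
      rw [eq_smul_edgePoint h2 hβ h rfl] at hp
      exact hne ⟨_, p.2, h, hp⟩
    have hmaps := hO.mapsTo
    obtain ⟨P, m, hm, hP, hper, rfl⟩ := hO
    have hPm : P ∈ {q | ∃ i < m, (f lam (β - lam))^[i] P = q} := ⟨0, hm, rfl⟩
    exact Or.inl ⟨P, hPm,
      fixed_of_periodic_of_abs_lt hβ hm hper fun n => hinside _ (hmaps.iterate n hPm)⟩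

/-- A trajectory on the edges that stays close to a finite set in the plane has edge coordinates
close to those of the set. -/
theorem exists_edgeCoords_close {lam β : ℝ} (h2 : lam < 0) (hβ : 1 < β) {O : Set (ℝ × ℝ)}
    (hfin : O.Finite) (hne : O.Nonempty) (hL : ∀ p ∈ O, inL p) {ε : ℝ} (hε : 0 < ε) :
    ∃ ε' > 0, ∀ σ v : ℝ, |σ| = 1 → Metric.infDist (σ • edgePoint lam β v) O < ε' →
      ∃ w ∈ edgeCoords lam β O, |v - w| < ε := by
  have hκ : 0 < (β - 1) / (1 - lam) := div_pos (by linarith) (by linarith)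
  have hev : ∀ᶠ ε' in 𝓝[>] (0 : ℝ), ∀ p ∈ O, |p.2| < 1 → ε' < 1 - |p.2| := by
    rw [eventually_all_finite hfin]
    intro p _
    by_cases hp : |p.2| < 1
    · filter_upwards [mem_nhdsWithin_of_mem_nhds (gt_mem_nhds (sub_pos.2 hp))] with ε' h _ using h
    · exact Eventually.of_forall fun _ h => absurd h hp
  obtain ⟨ε', ⟨⟨hgap, hpos⟩, hε'1⟩, hε'ε⟩ := (((hev.and self_mem_nhdsWithin).and
    (mem_nhdsWithin_of_mem_nhds (gt_mem_nhds one_pos))).and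
    (mem_nhdsWithin_of_mem_nhds (gt_mem_nhds (mul_pos hκ hε)))).exists
  refine ⟨ε', hpos, fun σ v hσ hd => ?_⟩
  obtain ⟨p, hp, hpd⟩ := (Metric.infDist_lt_iff hne).1 hd
  rw [Prod.dist_eq, max_lt_iff, Real.dist_eq, Real.dist_eq] at hpd
  obtain ⟨hd₁, hd₂⟩ := hpd
  have hd₂ : |σ - p.2| < ε' := by simpa [edgePoint] using hd₂
  have hp1 : |p.2| = 1 := by
    refine le_antisymm (hL p hp) (not_lt.1 fun hlt => ?_)
    have h₁ := hgap p hp hlt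
    have h₂ := abs_sub_abs_le_abs_sub σ p.2
    linarith
  have hpσ : p.2 = σ := by
    rcases (abs_eq zero_le_one).1 hσ with rfl | rfl <;>
    rcases (abs_eq zero_le_one).1 hp1 with h | h <;> rw [h] at hd₂ ⊢ <;> norm_num at hd₂ <;>
    linarith
  have hpe := eq_smul_edgePoint h2 hβ hσ hpσ
  generalize (σ * p.1 - 1) / ((β - 1) / (1 - lam)) - 1 = w at hpe
  refine ⟨w, ⟨σ, hσ, hpe ▸ hp⟩, ?_⟩
  have e : (σ • edgePoint lam β v).1 - p.1 = σ * ((β - 1) / (1 - lam) * (v - w)) := by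
    rw [hpe]
    simp only [edgePoint, Prod.smul_fst, smul_eq_mul]
    ring
  rw [e, abs_mul, hσ, one_mul, abs_mul, abs_of_pos hκ] at hd₁
  exact lt_of_mul_lt_mul_left (hd₁.trans hε'ε) hκ.le

/-- Outside every `OmegaSet k`, the first power of `β` exceeding `-1 / lam` comes with an expanding
branch of the return map. -/
theorem exists_expanding_index {lam β : ℝ} (h1 : -1 < lam) (h2 : lam < 0) (hβ : 1 < β)
    (h : ∀ k : ℕ, 1 ≤ k → (lam, β) ∉ OmegaSet k) :
    ∃ k : ℕ, -lam * β ^ k ≤ 1 ∧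
      1 < -lam * ((β ^ (k + 1) - 1) * ((1 - lam) / (β - 1)) - 1) := by
  classical
  have hone : 1 < -1 / lam := by rw [lt_div_iff_of_neg h2]; linarith
  have hex : ∃ k : ℕ, -1 / lam < β ^ k := pow_unbounded_of_one_lt _ hβ
  have hspec := Nat.find_spec hex
  have hmin := fun {m : ℕ} => Nat.find_min hex (m := m)
  generalize Nat.find hex = j at hspec hmin
  cases j with
  | zero => norm_num at hspec; linarith
  | succ k =>
    have hk := not_lt.1 (hmin k.lt_succ_self)
    refine ⟨k, ?_, ?_⟩
    · rw [le_div_iff_of_neg h2] at hk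
      linarith
    · have hS : -1 / lam < (β ^ (k + 1) - 1) / (β - 1) := by
        by_contra! hc
        exact h (k + 1) (by omega) ⟨hc, hspec, hβ, hone⟩
      rw [div_lt_iff_of_neg h2] at hS
      rw [mul_div_left_comm]
      nlinarith [mul_pos (neg_pos.2 h2) (sub_pos.2 hS)]

/-- Theorem 2 (non-existence part): if (λ, β) belongs to no Ω_k, then every periodic
orbit of f is unstable. -/
theorem stmt12 (lam a : ℝ) (h1 : -1 < lam) (h2 : lam < 0) (h3 : 1 < lam + a)
    (h4 : ∀ k : ℕ, 1 ≤ k → (lam, lam + a) ∉ OmegaSet k) :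
    ∀ O : Set (ℝ × ℝ), IsPeriodicOrbit lam a O → ¬ IsStableSet lam a O := by
  obtain ⟨β, rfl⟩ : ∃ β, a = β - lam := ⟨lam + a, by ring⟩
  rw [add_sub_cancel] at h3 h4
  intro O hO hst
  rcases hO.fixed_or_edgeCoords h2 h3 with ⟨p, hp, hfix⟩ | ⟨h0, hpos⟩
  · rw [hO.eq_singleton hp hfix] at hst
    exact not_isStableSet_singleton h3 (hO.inL_of_mem hp) hfix hst
  obtain ⟨k, hk, hγ⟩ := exists_expanding_index h1 h2 h3 h4
  have hq : 1 ≤ β ^ k := one_le_pow₀ h3.le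
  have hRpos : ∀ u ∈ edgeCoords lam β O, 0 < u →
      returnMap lam β u ∈ edgeCoords lam β O ∧ 0 < returnMap lam β u := by
    intro u hu hu0
    have hR := returnMap_mem_edgeCoords h2 h3 hO.mapsTo hu0.le hu
    exact ⟨hR, lt_of_le_of_ne (returnMap_nonneg h2 u) fun h => h0 (h ▸ hR)⟩
  obtain ⟨u, ⟨hu, hu0⟩, hmin⟩ := Set.exists_min_image
    {u | u ∈ edgeCoords lam β O ∧ 0 < u} id
    ((finite_edgeCoords h2 h3 hO.finite).subset fun _ h => h.1) hpos
  have hule : (β ^ k - 1) * u ≤ 2 := by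
    by_contra! hc
    have h₁ : u ≤ returnMap lam β u := hmin _ (hRpos u hu hu0)
    have h₂ := returnMap_le h2 h3 hu0.le
    nlinarith
  obtain ⟨ε, hε, hesc⟩ := exists_escape_of_expanding (R := returnMap lam β)
    (U' := {u | u ∈ edgeCoords lam β O ∧ 0 < u ∧ (β ^ k - 1) * u ≤ 2})
    (V := {v | 0 ≤ v ∧ (β ^ k - 1) * v < 2}) hγ (finite_edgeCoords h2 h3 hO.finite)
    (fun _ h => h.1)
    (fun v ⟨hv, hv0, hvk⟩ => by
      obtain ⟨h₁, h₂⟩ := hRpos v hv hv0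
      have h₃ := returnMap_le h2 h3 hv0.le
      exact ⟨h₁, h₂, by nlinarith⟩)
    (fun v ⟨hv0, hvk⟩ => by
      have h₃ := returnMap_le h2 h3 hv0
      exact ⟨returnMap_nonneg h2 v, by nlinarith⟩)
    (fun v ⟨hv, hv0, _⟩ => (eventually_expand h1 h2 h3 hv0 (hRpos v hv hv0).2).mono
      fun w hw hwV => hw hwV.2)
    (fun v ⟨_, hv0, _⟩ => continuousAt_returnMap h2 h3 hv0)
  obtain ⟨ε', hε', hclose⟩ := exists_edgeCoords_close h2 h3 hO.finite hO.nonempty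
    (fun _ => hO.inL_of_mem) hε
  obtain ⟨δ, hδ, hstab⟩ := hst ε' hε'
  obtain ⟨σ, hσ, hmem⟩ := hu
  have hcont : ContinuousAt (fun v => Metric.infDist (σ • edgePoint lam β v) O) u := by
    have : Continuous fun v => σ • edgePoint lam β v := by
      unfold edgePoint
      fun_prop
    exact ((Metric.continuous_infDist_pt O).comp this).continuousAt
  have hev := (hcont.eventually_lt_const ((Metric.infDist_zero_of_mem hmem).trans_lt hδ)).and
    ((lt_mem_nhds hu0).and (Metric.ball_mem_nhds u hε))
  obtain ⟨v, ⟨hvδ, hv0, hvε⟩, hvu⟩ :=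
    ((hev.filter_mono nhdsWithin_le_nhds).and (self_mem_nhdsWithin (s := Set.Iio u))).exists
  have hvu : v < u := hvu
  have hvV : (β ^ k - 1) * v < 2 := by nlinarith
  obtain ⟨n, hn⟩ := hesc u ⟨⟨σ, hσ, hmem⟩, hu0, hule⟩ v ⟨hv0.le, hvV⟩ hvu.ne hvε
  obtain ⟨N, τ, hτ, hN⟩ := exists_iterate_eq_returnMap_iterate h2 h3 hv0.le n
  have hin : inL (σ • edgePoint lam β v) := by
    simp [inL, edgePoint, hσ]
  have hfar := hstab _ (isTraj_iterate hin) hvδ N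
  simp only [f_iterate_smul hσ, hN, smul_smul] at hfar
  obtain ⟨w, hw, hwlt⟩ := hclose (σ * τ) _ (by rw [abs_mul, hσ, hτ, one_mul]) hfar
  exact (hn w hw).not_gt hwlt
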